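/- Let A be an n₁ × n₂ complex matrix with rank A = r₁ and B an n₃ × n₄ complex matrix with rank B = r₂, and define the fourth-order tensor F(i₁,i₂,i₃,i₄) = A(i₁,i₂)·B(i₃,i₄). Then the CP-rank of F equals r₁·r₂: F admits a CP decomposition with r₁·r₂ terms, and every CP decomposition of F has at least r₁·r₂ terms. -/

import Mathlib

open Matrix Kronecker

namespace Matrix

variable {K l m n o : Type*} [Field K] [Fintype l] [Fintype m] [Fintype n] [Fintype o]

/-- Rank factorization: a matrix of rank `r` is the product of a left-invertible matrix with `r`
columns and a right-invertible matrix with `r` rows. -/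
theorem exists_rank_factorization (A : Matrix m n K) {r : ℕ} (hr : A.rank = r) :
    ∃ (P : Matrix m (Fin r) K) (Q : Matrix (Fin r) n K)
      (P' : Matrix (Fin r) m K) (Q' : Matrix n (Fin r) K),
      A = P * Q ∧ P' * P = 1 ∧ Q * Q' = 1 := by
  classical
  let f := toLin' A
  let e : LinearMap.range f ≃ₗ[K] (Fin r → K) :=
    LinearEquiv.ofFinrankEq _ _ (by rw [Module.finrank_fin_fun]; exact hr)
  let g := e.toLinearMap ∘ₗ f.rangeRestrict
  let h := (LinearMap.range f).subtype ∘ₗ e.symm.toLinearMap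
  have hg : LinearMap.range g = ⊤ :=
    LinearMap.range_eq_top.2 (e.surjective.comp f.surjective_rangeRestrict)
  have hh : LinearMap.ker h = ⊥ :=
    LinearMap.ker_eq_bot.2 (Subtype.val_injective.comp e.symm.injective)
  obtain ⟨g', hg'⟩ := g.exists_rightInverse_of_surjective hg
  obtain ⟨h', hh'⟩ := h.exists_leftInverse_of_injective hh
  refine ⟨LinearMap.toMatrix' h, LinearMap.toMatrix' g, LinearMap.toMatrix' h',
    LinearMap.toMatrix' g', ?_, ?_, ?_⟩
  · have hf : h ∘ₗ g = f := by
      ext; simp [g, h]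
    rw [← LinearMap.toMatrix'_comp, hf, LinearMap.toMatrix'_toLin']
  · rw [← LinearMap.toMatrix'_comp, hh', LinearMap.toMatrix'_id]
  · rw [← LinearMap.toMatrix'_comp, hg', LinearMap.toMatrix'_id]

theorem rank_mul_rank_le_rank_kronecker (A : Matrix l m K) (B : Matrix n o K) :
    A.rank * B.rank ≤ (A ⊗ₖ B).rank := by
  obtain ⟨r, hr⟩ : ∃ r, A.rank = r := ⟨_, rfl⟩
  obtain ⟨k, hk⟩ : ∃ k, B.rank = k := ⟨_, rfl⟩
  obtain ⟨P, Q, P', Q', hA, hP, hQ⟩ := A.exists_rank_factorization hr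
  obtain ⟨R, S, R', S', hB, hR, hS⟩ := B.exists_rank_factorization hk
  have hA1 : P' * A * Q' = 1 := by
    rw [hA, ← Matrix.mul_assoc, hP, Matrix.one_mul, hQ]
  have hB1 : R' * B * S' = 1 := by
    rw [hB, ← Matrix.mul_assoc, hR, Matrix.one_mul, hS]
  calc A.rank * B.rank = ((P' ⊗ₖ R') * (A ⊗ₖ B) * (Q' ⊗ₖ S')).rank := by
        rw [← mul_kronecker_mul, ← mul_kronecker_mul, hA1, hB1, one_kronecker_one, rank_one, hr, hk]
        simp
    _ ≤ ((P' ⊗ₖ R') * (A ⊗ₖ B)).rank := rank_mul_le_left _ _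
    _ ≤ (A ⊗ₖ B).rank := rank_mul_le_right _ _

end Matrix

/-- The CP-rank of the fourth-order tensor `F(i₁,i₂,i₃,i₄) = A(i₁,i₂)·B(i₃,i₄)` equals
`rank A · rank B`: `F` admits a CP decomposition with `r₁·r₂` terms, and every CP
decomposition of `F` has at least `r₁·r₂` terms. -/
theorem stmt_11 {n₁ n₂ n₃ n₄ r₁ r₂ : ℕ}
    (A : Matrix (Fin n₁) (Fin n₂) ℂ) (B : Matrix (Fin n₃) (Fin n₄) ℂ)
    (hA : A.rank = r₁) (hB : B.rank = r₂) :
    (∃ (a : Fin (r₁ * r₂) → Fin n₁ → ℂ) (b : Fin (r₁ * r₂) → Fin n₂ → ℂ)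
       (c : Fin (r₁ * r₂) → Fin n₃ → ℂ) (e : Fin (r₁ * r₂) → Fin n₄ → ℂ),
      ∀ i₁ i₂ i₃ i₄, A i₁ i₂ * B i₃ i₄ = ∑ p, a p i₁ * b p i₂ * c p i₃ * e p i₄) ∧
    (∀ (s : ℕ) (a : Fin s → Fin n₁ → ℂ) (b : Fin s → Fin n₂ → ℂ)
       (c : Fin s → Fin n₃ → ℂ) (e : Fin s → Fin n₄ → ℂ),
      (∀ i₁ i₂ i₃ i₄, A i₁ i₂ * B i₃ i₄ = ∑ p, a p i₁ * b p i₂ * c p i₃ * e p i₄) →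
      r₁ * r₂ ≤ s) := by
  subst hA hB
  constructor
  · obtain ⟨P, Q, -, -, hA, -, -⟩ := A.exists_rank_factorization rfl
    obtain ⟨R, S, -, -, hB, -, -⟩ := B.exists_rank_factorization rfl
    refine ⟨fun p i => P i (finProdFinEquiv.symm p).1, fun p i => Q (finProdFinEquiv.symm p).1 i,
      fun p i => R i (finProdFinEquiv.symm p).2, fun p i => S (finProdFinEquiv.symm p).2 i,
      fun i₁ i₂ i₃ i₄ => ?_⟩
    rw [finProdFinEquiv.symm.sum_comp (fun q => P i₁ q.1 * Q q.1 i₂ * R i₃ q.2 * S q.2 i₄),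
      congrFun₂ hA i₁ i₂, congrFun₂ hB i₃ i₄, mul_apply, mul_apply, Finset.sum_mul_sum,
      Fintype.sum_prod_type]
    simp only [mul_assoc]
  · intro s a b c e h
    have hF : A ⊗ₖ B = (of fun (i : Fin n₁ × Fin n₃) p => a p i.1 * c p i.2) *
        (of fun p (j : Fin n₂ × Fin n₄) => b p j.1 * e p j.2) := by
      ext ⟨i₁, i₃⟩ ⟨i₂, i₄⟩
      simp only [kronecker_apply, mul_apply, of_apply, h]
      exact Finset.sum_congr rfl fun _ _ => by ring
    calc A.rank * B.rank ≤ (A ⊗ₖ B).rank := rank_mul_rank_le_rank_kronecker A B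
      _ ≤ (of fun (i : Fin n₁ × Fin n₃) p => a p i.1 * c p i.2).rank := by
        rw [hF]; exact rank_mul_le_left _ _
      _ ≤ s := by
        simpa using rank_le_card_width (of fun (i : Fin n₁ × Fin n₃) p => a p i.1 * c p i.2)
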